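/- Let ν ∝ e^{-V} and μ ∝ e^{-(1+α)V} be probability densities on ℝⁿ with V convex, and let q > 1. If α ≥ 0, then the q-Rényi divergence satisfies R_q(μ ‖ ν) ≤ q n α² / 2. -/

import Mathlib

open MeasureTheory
open scoped ENNReal Pointwise

theorem Real.volume_add_volume_le_volume_add {K L : Set ℝ} (hK : IsCompact K) (hL : IsCompact L)
    (hK0 : K.Nonempty) (hL0 : L.Nonempty) : volume K + volume L ≤ volume (K + L) := by
  obtain ⟨a, ha, haK⟩ := hK.exists_isGreatest hK0
  obtain ⟨b, hb, hbL⟩ := hL.exists_isLeast hL0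
  have hdisj : AEDisjoint volume (b +ᵥ K) (a +ᵥ L) := by
    refine measure_mono_null (t := {a + b}) ?_ (by simp)
    rintro _ ⟨⟨x, hx, rfl⟩, ⟨y, hy, hxy⟩⟩
    have := haK hx
    have := hbL hy
    simp only [vadd_eq_add] at hxy ⊢
    rw [Set.mem_singleton_iff]
    linarith
  calc volume K + volume L = volume (b +ᵥ K) + volume (a +ᵥ L) := by simp only [measure_vadd]
    _ = volume ((b +ᵥ K) ∪ (a +ᵥ L)) :=
      (measure_union₀ (hL.measurableSet.const_vadd a).nullMeasurableSet hdisj).symm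
    _ ≤ volume (K + L) := by
      refine measure_mono (Set.union_subset ?_ ?_)
      · rintro _ ⟨x, hx, rfl⟩
        exact ⟨x, hx, b, hb, add_comm x b⟩
      · rintro _ ⟨y, hy, rfl⟩
        exact ⟨a, ha, y, hy, rfl⟩

/-- The one-dimensional Brunn–Minkowski inequality. -/
theorem Real.volume_add_volume_le {A B C : Set ℝ} (hA : MeasurableSet A) (hB : MeasurableSet B)
    (hA0 : A.Nonempty) (hB0 : B.Nonempty) (hC : A + B ⊆ C) :
    volume A + volume B ≤ volume C := by
  obtain ⟨a, ha⟩ := hA0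
  obtain ⟨b, hb⟩ := hB0
  rw [hA.measure_eq_iSup_isCompact, hB.measure_eq_iSup_isCompact]
  simp only [iSup_and']
  refine ENNReal.biSup_add_biSup_le' (p := fun K => K ⊆ A ∧ IsCompact K)
    (q := fun K => K ⊆ B ∧ IsCompact K) ⟨∅, Set.empty_subset A, isCompact_empty⟩
    ⟨∅, Set.empty_subset B, isCompact_empty⟩ ?_
  rintro K ⟨hKA, hK⟩ L ⟨hLB, hL⟩
  calc volume K + volume L ≤ volume (insert a K) + volume (insert b L) := by
        gcongr <;> exact Set.subset_insert _ _
    _ ≤ volume (insert a K + insert b L) :=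
      Real.volume_add_volume_le_volume_add (hK.insert a) (hL.insert b)
        (Set.insert_nonempty _ _) (Set.insert_nonempty _ _)
    _ ≤ volume C := measure_mono ((Set.add_subset_add (Set.insert_subset ha hKA)
        (Set.insert_subset hb hLB)).trans hC)

theorem Real.ofReal_mul_volume_add_le {A B C : Set ℝ} {s t : ℝ} (hs : 0 < s) (ht : 0 < t)
    (hA : MeasurableSet A) (hB : MeasurableSet B) (hA0 : A.Nonempty) (hB0 : B.Nonempty)
    (hC : ∀ x ∈ A, ∀ y ∈ B, s * x + t * y ∈ C) :
    ENNReal.ofReal s * volume A + ENNReal.ofReal t * volume B ≤ volume C := by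
  have h := Real.volume_add_volume_le (A := s • A) (B := t • B) (C := C)
    (hA.const_smul_of_ne_zero hs.ne') (hB.const_smul_of_ne_zero ht.ne') hA0.smul_set hB0.smul_set ?_
  · simpa [abs_of_pos hs, abs_of_pos ht] using h
  · rintro _ ⟨_, ⟨x, hx, rfl⟩, _, ⟨y, hy, rfl⟩, rfl⟩
    exact hC x hx y hy

theorem lintegral_eq_lintegral_meas_ofReal_lt {α : Type*} [MeasurableSpace α] (μ : Measure α)
    {f : α → ℝ≥0∞} (hf : Measurable f) (hf_top : ∀ x, f x ≠ ∞) :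
    ∫⁻ x, f x ∂μ = ∫⁻ r in Set.Ioi (0 : ℝ), μ {x | ENNReal.ofReal r < f x} := by
  have h := lintegral_eq_lintegral_meas_lt μ (f := fun x => (f x).toReal)
    (Filter.Eventually.of_forall fun x => ENNReal.toReal_nonneg) hf.ennreal_toReal.aemeasurable
  simp only [ENNReal.ofReal_toReal (hf_top _)] at h
  rw [h]
  refine setLIntegral_congr_fun measurableSet_Ioi fun r hr => ?_
  simp only [ENNReal.ofReal_lt_iff_lt_toReal (le_of_lt hr) (hf_top _)]

theorem lintegral_add_lintegral_le_of_min_le {f g h : ℝ → ℝ≥0∞} {s t : ℝ}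
    (hs : 0 < s) (ht : 0 < t)
    (hf : Measurable f) (hg : Measurable g) (hh : Measurable h)
    (hf1 : ⨆ x, f x = 1) (hg1 : ⨆ x, g x = 1)
    (hfgh : ∀ x y, min (f x) (g y) ≤ h (s * x + t * y)) :
    ENNReal.ofReal s * (∫⁻ x, f x) + ENNReal.ofReal t * (∫⁻ x, g x) ≤ ∫⁻ x, h x := by
  have hfle (x) : f x ≤ 1 := hf1 ▸ le_iSup f x
  have hgle (x) : g x ≤ 1 := hg1 ▸ le_iSup g x
  have ne_top {c : ℝ≥0∞} (hc : c ≤ 1) : c ≠ ∞ := ne_top_of_le_ne_top ENNReal.one_ne_top hc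
  refine le_trans ?_ (lintegral_mono fun x => min_le_left (h x) 1)
  rw [lintegral_eq_lintegral_meas_ofReal_lt _ hf fun x => ne_top (hfle x),
    lintegral_eq_lintegral_meas_ofReal_lt _ hg fun x => ne_top (hgle x),
    lintegral_eq_lintegral_meas_ofReal_lt _ (hh.min measurable_const)
      fun x => ne_top (min_le_right _ _),
    ← lintegral_const_mul' _ _ ENNReal.ofReal_ne_top,
    ← lintegral_const_mul' _ _ ENNReal.ofReal_ne_top, ← lintegral_add_left]
  · refine lintegral_mono fun r => ?_
    rcases le_or_gt 1 (ENNReal.ofReal r) with hr | hr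
    · have hf' (x) : ¬ ENNReal.ofReal r < f x := ((hfle x).trans hr).not_gt
      have hg' (x) : ¬ ENNReal.ofReal r < g x := ((hgle x).trans hr).not_gt
      simp [hf', hg']
    · refine Real.ofReal_mul_volume_add_le hs ht (measurableSet_lt measurable_const hf)
        (measurableSet_lt measurable_const hg) (lt_iSup_iff.1 (hr.trans_eq hf1.symm))
        (lt_iSup_iff.1 (hr.trans_eq hg1.symm)) fun x hx y hy => ?_
      exact lt_min ((lt_min hx hy).trans_le (hfgh x y)) hr
  · refine Measurable.const_mul (Antitone.measurable fun a b hab => measure_mono fun x hx => ?_) _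
    exact (ENNReal.ofReal_le_ofReal hab).trans_lt hx

theorem ENNReal.geom_mean_le_arith_mean2_weighted (a b : ℝ≥0∞) {s t : ℝ} (hs : 0 < s) (ht : 0 < t)
    (hst : s + t = 1) :
    a ^ s * b ^ t ≤ ENNReal.ofReal s * a + ENNReal.ofReal t * b := by
  have hpq : (s⁻¹).HolderConjugate t⁻¹ :=
    ⟨by simpa using hst, by positivity, by positivity⟩
  have := ENNReal.young_inequality (a ^ s) (b ^ t) hpq
  simpa [← ENNReal.rpow_mul, hs.ne', ht.ne', ENNReal.ofReal_inv_of_pos, hs, ht,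
    ENNReal.div_eq_inv_mul] using this

theorem ENNReal.min_le_geom_mean (a b : ℝ≥0∞) {s t : ℝ} (hs : 0 < s) (ht : 0 < t)
    (hst : s + t = 1) : min a b ≤ a ^ s * b ^ t := by
  calc min a b = (min a b) ^ s * (min a b) ^ t := by
        rw [← ENNReal.rpow_add_of_nonneg _ _ hs.le ht.le, hst, ENNReal.rpow_one]
    _ ≤ a ^ s * b ^ t := by gcongr <;> simp

theorem prekopa_leindler_real_of_bounded {f g h : ℝ → ℝ≥0∞} {s t : ℝ}
    (hs : 0 < s) (ht : 0 < t) (hst : s + t = 1)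
    (hf : Measurable f) (hg : Measurable g) (hh : Measurable h)
    (hf_top : ⨆ x, f x ≠ ∞) (hg_top : ⨆ x, g x ≠ ∞)
    (hfgh : ∀ x y, f x ^ s * g y ^ t ≤ h (s * x + t * y)) :
    (∫⁻ x, f x) ^ s * (∫⁻ x, g x) ^ t ≤ ∫⁻ x, h x := by
  set a := ⨆ x, f x with ha
  set b := ⨆ x, g x with hb
  rcases eq_or_ne a 0 with ha0 | ha0
  · have : ∀ x, f x = 0 := by simpa using ha.symm.trans ha0
    simp [this, hs]
  rcases eq_or_ne b 0 with hb0 | hb0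
  · have : ∀ x, g x = 0 := by simpa using hb.symm.trans hb0
    simp [this, ht]
  have hc0 : a ^ s * b ^ t ≠ 0 := by simp [ha0, hb0, hf_top, hg_top]
  have hc_top : a ^ s * b ^ t ≠ ∞ :=
    ENNReal.mul_ne_top (ENNReal.rpow_ne_top_of_nonneg hs.le hf_top)
      (ENNReal.rpow_ne_top_of_nonneg ht.le hg_top)
  have hdiv (u v : ℝ≥0∞) :
      (a⁻¹ * u) ^ s * (b⁻¹ * v) ^ t = (a ^ s * b ^ t)⁻¹ * (u ^ s * v ^ t) := by
    rw [ENNReal.mul_rpow_of_nonneg _ _ hs.le, ENNReal.mul_rpow_of_nonneg _ _ ht.le,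
      ENNReal.inv_rpow, ENNReal.inv_rpow, ENNReal.mul_inv (by simp [ha0, hf_top])
        (by simp [hb0, hg_top])]
    ring
  have key := lintegral_add_lintegral_le_of_min_le (f := fun x => a⁻¹ * f x)
    (g := fun x => b⁻¹ * g x) (h := fun x => (a ^ s * b ^ t)⁻¹ * h x) hs ht
    (hf.const_mul _) (hg.const_mul _) (hh.const_mul _)
    (by rw [← ENNReal.mul_iSup, ENNReal.inv_mul_cancel ha0 hf_top])
    (by rw [← ENNReal.mul_iSup, ENNReal.inv_mul_cancel hb0 hg_top])
    (fun x y => (ENNReal.min_le_geom_mean _ _ hs ht hst).trans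
      (by rw [hdiv]; gcongr; exact hfgh x y))
  replace key := (ENNReal.geom_mean_le_arith_mean2_weighted _ _ hs ht hst).trans key
  rw [lintegral_const_mul _ hf, lintegral_const_mul _ hg, lintegral_const_mul _ hh, hdiv] at key
  exact (ENNReal.mul_le_mul_iff_right (by simpa using hc_top) (by simpa using hc0)).1 key

/-- The one-dimensional Prékopa–Leindler inequality. -/
theorem prekopa_leindler_real {f g h : ℝ → ℝ≥0∞} {s t : ℝ}
    (hs : 0 < s) (ht : 0 < t) (hst : s + t = 1)
    (hf : Measurable f) (hg : Measurable g) (hh : Measurable h)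
    (hfgh : ∀ x y, f x ^ s * g y ^ t ≤ h (s * x + t * y)) :
    (∫⁻ x, f x) ^ s * (∫⁻ x, g x) ^ t ≤ ∫⁻ x, h x := by
  have hlim {f : ℝ → ℝ≥0∞} (hf : Measurable f) :
      Filter.Tendsto (fun N : ℕ => ∫⁻ x, min (f x) N) Filter.atTop (nhds (∫⁻ x, f x)) := by
    refine lintegral_tendsto_of_tendsto_of_monotone (fun N => (hf.min measurable_const).aemeasurable)
      (Filter.Eventually.of_forall fun x m n hmn => by dsimp only; gcongr)
      (Filter.Eventually.of_forall fun x => ?_)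
    simpa using (tendsto_const_nhds (x := f x)).min ENNReal.tendsto_nat_nhds_top
  have hbd (f : ℝ → ℝ≥0∞) (N : ℕ) : ⨆ x, min (f x) N ≠ ∞ :=
    ne_top_of_le_ne_top (ENNReal.natCast_ne_top N) (iSup_le fun x => min_le_right _ _)
  have hrpow {u : ℕ → ℝ≥0∞} {a : ℝ≥0∞} (hu : Filter.Tendsto u Filter.atTop (nhds a)) {s : ℝ} :
      Filter.Tendsto (fun N => u N ^ s) Filter.atTop (nhds (a ^ s)) :=
    (ENNReal.continuous_rpow_const.tendsto a).comp hu
  have hbdd (N : ℕ) : (∫⁻ x, min (f x) N) ^ s * (∫⁻ x, min (g x) N) ^ t ≤ ∫⁻ x, h x :=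
    prekopa_leindler_real_of_bounded hs ht hst (hf.min measurable_const) (hg.min measurable_const)
      hh (hbd f N) (hbd g N) fun x y => le_trans (by gcongr <;> exact min_le_left _ _) (hfgh x y)
  have hle {f : ℝ → ℝ≥0∞} (N : ℕ) : ∫⁻ x, min (f x) N ≤ ∫⁻ x, f x :=
    lintegral_mono fun x => min_le_left _ _
  rcases eq_or_ne (∫⁻ x, f x) 0 with h0 | h0
  · simp [h0, hs]
  rcases eq_or_ne (∫⁻ x, g x) 0 with h0' | h0'
  · simp [h0', ht]
  refine le_of_tendsto' (ENNReal.Tendsto.mul (hrpow (hlim hf)) (Or.inl ?_) (hrpow (hlim hg))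
    (Or.inl ?_)) hbdd
  all_goals simp [h0, h0', not_lt.2 hs.le, not_lt.2 ht.le]

theorem prekopa_leindler_pi {n : ℕ} {f g h : (Fin n → ℝ) → ℝ≥0∞} {s t : ℝ}
    (hs : 0 < s) (ht : 0 < t) (hst : s + t = 1)
    (hf : Measurable f) (hg : Measurable g) (hh : Measurable h)
    (hfgh : ∀ x y, f x ^ s * g y ^ t ≤ h (s • x + t • y)) :
    (∫⁻ x, f x) ^ s * (∫⁻ x, g x) ^ t ≤ ∫⁻ x, h x := by
  induction n with
  | zero =>
    have h0 (k : (Fin 0 → ℝ) → ℝ≥0∞) : ∫⁻ x, k x = k 0 := by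
      rw [volume_pi, Measure.pi_of_empty _ 0]
      simp
    simpa [h0] using hfgh 0 0
  | succ n ih =>
    let e := MeasurableEquiv.piFinSuccAbove (fun _ : Fin (n + 1) => ℝ) 0
    have he : Measurable e.symm := e.symm.measurable
    have hfub {k : (Fin (n + 1) → ℝ) → ℝ≥0∞} (hk : Measurable k) :
        ∫⁻ x, k x = ∫⁻ a, ∫⁻ v, k (e.symm (a, v)) := by
      rw [← ((volume_preserving_piFinSuccAbove (fun _ => ℝ) 0).symm).lintegral_comp hk]
      exact lintegral_prod _ (hk.comp he).aemeasurable
    have hsec {k : (Fin (n + 1) → ℝ) → ℝ≥0∞} (hk : Measurable k) (a : ℝ) :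
        Measurable fun v => k (e.symm (a, v)) := hk.comp (he.comp measurable_prodMk_left)
    have hmarg {k : (Fin (n + 1) → ℝ) → ℝ≥0∞} (hk : Measurable k) :
        Measurable fun a => ∫⁻ v, k (e.symm (a, v)) := (hk.comp he).lintegral_prod_right'
    rw [hfub hf, hfub hg, hfub hh]
    refine prekopa_leindler_real hs ht hst (hmarg hf) (hmarg hg) (hmarg hh) fun a b => ?_
    refine ih (hsec hf a) (hsec hg b) (hsec hh _) fun x y => ?_
    refine (hfgh _ _).trans_eq (congrArg h ?_)
    ext i
    refine Fin.cases ?_ (fun j => ?_) i <;> simp [e, MeasurableEquiv.piFinSuccAbove]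

/-- The Prékopa–Leindler inequality. -/
theorem prekopa_leindler {n : ℕ} {f g h : EuclideanSpace ℝ (Fin n) → ℝ≥0∞} {s t : ℝ}
    (hs : 0 < s) (ht : 0 < t) (hst : s + t = 1)
    (hf : Measurable f) (hg : Measurable g) (hh : Measurable h)
    (hfgh : ∀ x y, f x ^ s * g y ^ t ≤ h (s • x + t • y)) :
    (∫⁻ x, f x) ^ s * (∫⁻ x, g x) ^ t ≤ ∫⁻ x, h x := by
  have hmp := PiLp.volume_preserving_toLp (Fin n)
  rw [← hmp.lintegral_comp hf, ← hmp.lintegral_comp hg, ← hmp.lintegral_comp hh]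
  exact prekopa_leindler_pi hs ht hst (hf.comp hmp.measurable) (hg.comp hmp.measurable)
    (hh.comp hmp.measurable) fun x y => hfgh _ _

theorem ConvexOn.perspective_le {E : Type*} [AddCommGroup E] [Module ℝ E] {V : E → ℝ}
    (hV : ConvexOn ℝ Set.univ V) {a b s t : ℝ} (ha : 0 < a) (hb : 0 < b) (hs : 0 < s) (ht : 0 < t)
    (x y : E) :
    (s * a + t * b) * V ((s * a + t * b)⁻¹ • (s • x + t • y)) ≤
      s * (a * V (a⁻¹ • x)) + t * (b * V (b⁻¹ • y)) := by
  have hc : 0 < s * a + t * b := by positivity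
  have h := hV.2 (Set.mem_univ (a⁻¹ • x)) (Set.mem_univ (b⁻¹ • y))
    (show 0 ≤ s * a / (s * a + t * b) by positivity)
    (show 0 ≤ t * b / (s * a + t * b) by positivity)
    (by field_simp)
  have hx : (s * a + t * b)⁻¹ • (s • x + t • y) =
      (s * a / (s * a + t * b)) • a⁻¹ • x + (t * b / (s * a + t * b)) • b⁻¹ • y := by
    rw [smul_add, smul_smul, smul_smul, smul_smul, smul_smul]
    congr 2 <;> field_simp
  rw [hx]
  refine (mul_le_mul_of_nonneg_left h hc.le).trans_eq ?_
  simp only [smul_eq_mul]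
  field_simp

/-- Log-concavity of `s ↦ sⁿ ∫ exp (-s V)` for a convex function `V` on `ℝⁿ`. -/
theorem ConvexOn.rpow_pow_mul_integral_exp_le {n : ℕ} {V : EuclideanSpace ℝ (Fin n) → ℝ}
    (hV : ConvexOn ℝ Set.univ V) {a b s t : ℝ} (ha : 0 < a) (hb : 0 < b) (hs : 0 < s) (ht : 0 < t)
    (hst : s + t = 1) (hint : Integrable fun x => Real.exp (-((s * a + t * b) * V x))) :
    (a ^ n * ∫ x, Real.exp (-(a * V x))) ^ s * (b ^ n * ∫ x, Real.exp (-(b * V x))) ^ t ≤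
      (s * a + t * b) ^ n * ∫ x, Real.exp (-((s * a + t * b) * V x)) := by
  have hc : 0 < s * a + t * b := by positivity
  have hcont : Continuous V := by
    simpa using hV.continuousOn isOpen_univ
  have hmeas (r : ℝ) : Measurable fun x => ENNReal.ofReal (Real.exp (-(r * V (r⁻¹ • x)))) := by
    fun_prop
  have hZ {r : ℝ} (hr : 0 < r) : r ^ n * ∫ x, Real.exp (-(r * V x)) =
      (∫⁻ x, ENNReal.ofReal (Real.exp (-(r * V (r⁻¹ • x))))).toReal := by
    rw [← integral_eq_lintegral_of_nonneg_ae (Filter.Eventually.of_forall fun x => by positivity)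
      (by fun_prop), Measure.integral_comp_inv_smul_of_nonneg volume
        (fun x => Real.exp (-(r * V x))) hr.le]
    simp
  rw [hZ ha, hZ hb, hZ hc, ENNReal.toReal_rpow, ENNReal.toReal_rpow, ← ENNReal.toReal_mul]
  refine ENNReal.toReal_mono ?_ (prekopa_leindler hs ht hst (hmeas a) (hmeas b) (hmeas _) ?_)
  · exact (hint.comp_smul (inv_ne_zero hc.ne')).lintegral_lt_top.ne
  · intro x y
    rw [ENNReal.ofReal_rpow_of_pos (Real.exp_pos _), ENNReal.ofReal_rpow_of_pos (Real.exp_pos _),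
      ← ENNReal.ofReal_mul (by positivity), ← Real.exp_mul, ← Real.exp_mul, ← Real.exp_add]
    gcongr
    linarith [hV.perspective_le ha hb hs ht x y]

theorem Real.mul_log_one_add_sub_log_le {q α : ℝ} (hq : 1 < q) (hα : 0 ≤ α) :
    q * Real.log (1 + α) - Real.log (1 + q * α) ≤ q * (q - 1) * α ^ 2 / 2 := by
  let F : ℝ → ℝ := fun x => q * (q - 1) * x ^ 2 / 2 - (q * Real.log (1 + x) - Real.log (1 + q * x))
  have hderiv (x : ℝ) (hx : 0 ≤ x) :
      HasDerivAt F (q * (q - 1) * x - (q * (1 / (1 + x)) - q / (1 + q * x))) x := by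
    have h1 : HasDerivAt (fun x : ℝ => 1 + x) 1 x := (hasDerivAt_id x).const_add 1
    have h2 : HasDerivAt (fun x : ℝ => 1 + q * x) q x := by
      simpa using ((hasDerivAt_id x).const_mul q).const_add 1
    have h3 : HasDerivAt (fun x : ℝ => q * (q - 1) * x ^ 2 / 2) (q * (q - 1) * x) x := by
      refine (((hasDerivAt_pow 2 x).const_mul (q * (q - 1))).div_const 2).congr_deriv ?_
      simp
      ring
    exact h3.sub (((h1.log (by positivity)).const_mul q).sub (h2.log (by positivity)))
  have hmono : MonotoneOn F (Set.Ici 0) := by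
    refine monotoneOn_of_hasDerivWithinAt_nonneg (convex_Ici 0)
      (fun x hx => (hderiv x hx).continuousAt.continuousWithinAt)
      (fun x hx => (hderiv x (interior_subset hx)).hasDerivWithinAt) fun x hx => ?_
    have hx : 0 ≤ x := interior_subset hx
    have hqx : 0 ≤ q * x := by positivity
    have : q * (q - 1) * x - (q * (1 / (1 + x)) - q / (1 + q * x)) =
        q * (q - 1) * x * (1 - 1 / ((1 + x) * (1 + q * x))) := by
      field_simp
      ring
    rw [this]
    refine mul_nonneg (mul_nonneg (mul_nonneg (by linarith) (by linarith)) hx) ?_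
    rw [sub_nonneg, div_le_one (by positivity)]
    nlinarith
  have h := hmono (Set.self_mem_Ici) hα hα
  simp [F] at h
  linarith

theorem stmt3 (n : ℕ) (V : EuclideanSpace ℝ (Fin n) → ℝ)
    (hV : ConvexOn ℝ Set.univ V)
    (q α : ℝ) (hq : 1 < q) (hα : 0 ≤ α)
    (hν : Integrable (fun x => Real.exp (-V x)))
    (hμ : Integrable (fun x => Real.exp (-((1 + α) * V x)))) :
    (1 / (q - 1)) * Real.log (∫ x,
        ((Real.exp (-((1 + α) * V x)) / ∫ y, Real.exp (-((1 + α) * V y))) /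
            (Real.exp (-V x) / ∫ y, Real.exp (-V y))) ^ q *
          (Real.exp (-V x) / ∫ y, Real.exp (-V y)))
      ≤ q * n * α ^ 2 / 2 := by
  have hq0 : 0 < q := by linarith
  have hqα : 0 < 1 + q * α := by positivity
  set Z₁ := ∫ y, Real.exp (-V y) with hZ₁
  set Z₂ := ∫ y, Real.exp (-((1 + α) * V y)) with hZ₂
  have hZ₁_pos : 0 < Z₁ := integral_exp_pos hν
  have hZ₂_pos : 0 < Z₂ := integral_exp_pos hμ
  have hfun (x) : (Real.exp (-((1 + α) * V x)) / Z₂ / (Real.exp (-V x) / Z₁)) ^ q *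
      (Real.exp (-V x) / Z₁) = (Z₁ / Z₂) ^ q / Z₁ * Real.exp (-((1 + q * α) * V x)) := by
    have : Real.exp (-((1 + α) * V x)) / Z₂ / (Real.exp (-V x) / Z₁) =
        Z₁ / Z₂ * Real.exp (-(α * V x)) := by
      rw [show -((1 + α) * V x) = -V x + -(α * V x) by ring, Real.exp_add]
      field_simp
    rw [this, Real.mul_rpow (by positivity) (by positivity), ← Real.exp_mul,
      show -((1 + q * α) * V x) = -(α * V x) * q + -V x by ring, Real.exp_add]
    ring
  simp only [hfun]
  rw [integral_const_mul]
  by_cases hint : Integrable fun x => Real.exp (-((1 + q * α) * V x))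
  swap
  · rw [integral_undef hint]
    simp
    positivity
  have hZ₃_pos := integral_exp_pos hint
  have hmid : (1 - q⁻¹) * 1 + q⁻¹ * (1 + q * α) = 1 + α := by
    field_simp
    ring
  have key := hV.rpow_pow_mul_integral_exp_le one_pos hqα
    (sub_pos.2 (inv_lt_one_of_one_lt₀ hq)) (inv_pos.2 hq0) (sub_add_cancel 1 q⁻¹)
    (by rwa [hmid])
  simp only [hmid, one_pow, one_mul, ← hZ₁, ← hZ₂] at key
  set Z₃ := ∫ x, Real.exp (-((1 + q * α) * V x))
  have hlog := Real.log_le_log (by positivity) key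
  rw [Real.log_mul (by positivity) (by positivity), Real.log_rpow hZ₁_pos,
    Real.log_rpow (by positivity), Real.log_mul (by positivity) (by positivity),
    Real.log_mul (by positivity) (by positivity), Real.log_pow, Real.log_pow] at hlog
  replace hlog := mul_le_mul_of_nonneg_left hlog hq0.le
  have hlhs : q * ((1 - q⁻¹) * Real.log Z₁ + q⁻¹ * (n * Real.log (1 + q * α) + Real.log Z₃)) =
      (q - 1) * Real.log Z₁ + n * Real.log (1 + q * α) + Real.log Z₃ := by
    field_simp
    ring
  rw [hlhs] at hlog
  rw [Real.log_mul (by positivity) (by positivity), Real.log_div (by positivity) (by positivity),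
    Real.log_rpow (by positivity), Real.log_div (by positivity) (by positivity), one_div,
    inv_mul_le_iff₀ (by linarith)]
  have := mul_le_mul_of_nonneg_left (Real.mul_log_one_add_sub_log_le hq hα) n.cast_nonneg (α := ℝ)
  linarith
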